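/- arXiv:1211.0816 — 3 statements merged into one kernel-verified Lean document; each statement's English description precedes it below -/
import Mathlib

section
/- Let d(n,x) = det((r(i+j,x))_{i,j=0}^{n}) where r(n,x) = Σ_{k=0}^{n} C_{n-k} x^k, and d(n,0) = det((C_{i+j})_{i,j=0}^{n}). Then d(n,x)/d(n,0) = Σ_{j=0}^{n} (-1)^j binom(n+j, n-j) x^j as polynomials in x. -/
open Polynomial Finset

/-- The alternating binomial transform with weights `(n + j + c).choose (2 * j + c)`. For `c = 0, 1`
its values on powers of `t` are Chebyshev polynomials evaluated at `1 - t / 2`, of the third and of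
the second kind respectively. -/
def chebyshevTransform {R : Type*} [CommRing R] (c n : ℕ) (f : ℕ → R) : R :=
  ∑ j ∈ range (n + 1), (-1) ^ j * ((n + j + c).choose (2 * j + c) : R) * f j

section CommRing

variable {R : Type*} [CommRing R]

theorem chebyshevTransform_eq_sum_range {c n N : ℕ} (h : n < N) (f : ℕ → R) :
    chebyshevTransform c n f =
      ∑ j ∈ range N, (-1) ^ j * ((n + j + c).choose (2 * j + c) : R) * f j := by
  refine sum_subset (range_subset_range.2 h) fun j _ hj => ?_
  rw [Nat.choose_eq_zero_of_lt (by simp at hj; omega)]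
  simp

theorem choose_add_two_add_two (N K : ℕ) :
    ((N + 2).choose (K + 2) : R) =
      N.choose K + 2 * N.choose (K + 1) + N.choose (K + 2) := by
  simp only [Nat.choose_succ_succ', Nat.cast_add]
  ring

theorem chebyshevTransform_add_two {c : ℕ} (hc : c ≤ 1) (n : ℕ) (f : ℕ → R) :
    chebyshevTransform c (n + 2) f = 2 * chebyshevTransform c (n + 1) f -
      chebyshevTransform c (n + 1) (fun j => f (j + 1)) - chebyshevTransform c n f := by
  rw [chebyshevTransform_eq_sum_range (N := n + 2 + 1) (by omega) f,
    chebyshevTransform_eq_sum_range (n := n + 1) (N := n + 2 + 1) (by omega) f,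
    chebyshevTransform_eq_sum_range (n := n) (N := n + 2 + 1) (by omega) f,
    chebyshevTransform_eq_sum_range (n := n + 1) (N := n + 2) (by omega),
    sum_range_succ', sum_range_succ' _ (n + 2), sum_range_succ' _ (n + 2)]
  have h₀ : ((n + 2 + 0 + c).choose (2 * 0 + c) : R) =
      2 * (n + 1 + 0 + c).choose (2 * 0 + c) - (n + 0 + c).choose (2 * 0 + c) := by
    interval_cases c
    · simp; ring
    · simp; ring
  have h : ∀ j, (-1) ^ (j + 1) * ((n + 2 + (j + 1) + c).choose (2 * (j + 1) + c) : R) * f (j + 1) =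
      2 * ((-1) ^ (j + 1) * ((n + 1 + (j + 1) + c).choose (2 * (j + 1) + c) : R) * f (j + 1)) -
      (-1) ^ j * ((n + 1 + j + c).choose (2 * j + c) : R) * f (j + 1) -
      (-1) ^ (j + 1) * ((n + (j + 1) + c).choose (2 * (j + 1) + c) : R) * f (j + 1) := by
    intro j
    rw [show n + 2 + (j + 1) + c = n + 1 + j + c + 2 by ring,
      show n + 1 + (j + 1) + c = n + 1 + j + c + 1 by ring,
      show n + (j + 1) + c = n + 1 + j + c by ring,
      show 2 * (j + 1) + c = 2 * j + c + 2 by ring, choose_add_two_add_two,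
      Nat.choose_succ_succ' _ (2 * j + c + 1)]
    push_cast
    ring
  rw [sum_congr rfl fun j _ => h j, h₀]
  simp only [sum_sub_distrib, ← mul_sum]
  ring

theorem chebyshevTransform_add (c n : ℕ) (f g : ℕ → R) :
    chebyshevTransform c n (fun j => f j + g j) =
      chebyshevTransform c n f + chebyshevTransform c n g := by
  simp [chebyshevTransform, mul_add, sum_add_distrib]

theorem chebyshevTransform_const_mul (c n : ℕ) (a : R) (f : ℕ → R) :
    chebyshevTransform c n (fun j => a * f j) = a * chebyshevTransform c n f := by
  simp only [chebyshevTransform, mul_sum]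
  exact sum_congr rfl fun j _ => by ring

variable (R) in
/-- The ballot number `(n + 1) / (m + 1) * (2 * m + 2).choose (m - n)`. -/
def ballot (n m : ℕ) : R :=
  ((2 * m + 1).choose (m + 1 + n) : R) - (2 * m + 1).choose (m + 2 + n)

theorem ballot_eq_zero {n m : ℕ} (h : m < n) : ballot R n m = 0 := by
  simp [ballot, Nat.choose_eq_zero_of_lt (show 2 * m + 1 < m + 1 + n by omega),
    Nat.choose_eq_zero_of_lt (show 2 * m + 1 < m + 2 + n by omega)]

theorem ballot_self (n : ℕ) : ballot R n n = 1 := by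
  simp [ballot, show n + 1 + n = 2 * n + 1 by ring,
    Nat.choose_eq_zero_of_lt (show 2 * n + 1 < n + 2 + n by omega)]

theorem ballot_succ_succ (n m : ℕ) :
    ballot R (n + 1) (m + 1) = ballot R n m + 2 * ballot R (n + 1) m + ballot R (n + 2) m := by
  rw [ballot, show 2 * (m + 1) + 1 = 2 * m + 1 + 2 by ring,
    show m + 1 + 1 + (n + 1) = m + 1 + n + 2 by ring,
    show m + 1 + 2 + (n + 1) = m + 2 + n + 2 by ring,
    choose_add_two_add_two, choose_add_two_add_two]
  simp only [ballot]
  ring_nf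

theorem ballot_zero_succ (m : ℕ) :
    ballot R 0 (m + 1) = 2 * ballot R 0 m + ballot R 1 m := by
  rw [ballot, show 2 * (m + 1) + 1 = 2 * m + 1 + 2 by ring,
    show m + 1 + 1 + 0 = m + 2 by ring, show m + 1 + 2 + 0 = m + 1 + 2 by ring,
    choose_add_two_add_two, choose_add_two_add_two, ← Nat.choose_symm_half m]
  simp only [ballot]
  ring_nf

theorem ballot_zero (m : ℕ) : ballot R 0 m = catalan (m + 1) := by
  have key : (2 * m + 1).choose (m + 1) = catalan (m + 1) + (2 * m + 1).choose (m + 2) := by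
    have h₁ := Nat.choose_succ_right_eq (2 * m + 1) (m + 1)
    rw [show 2 * m + 1 - (m + 1) = m by omega] at h₁
    have h₂ := succ_mul_catalan_eq_centralBinom (m + 1)
    rw [Nat.centralBinom, show 2 * (m + 1) = 2 * m + 1 + 1 by ring, Nat.choose_succ_succ',
      ← Nat.choose_symm_half m] at h₂
    refine Nat.eq_of_mul_eq_mul_left (show 0 < m + 1 + 1 by omega) ?_
    linarith
  simp [ballot, key]

theorem chebyshevTransform_one_catalan (n m : ℕ) :
    chebyshevTransform 1 n (fun j => (catalan (m + 1 + j) : R)) = (-1) ^ n * ballot R n m := by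
  induction n using Nat.twoStepInduction generalizing m with
  | zero => simp [chebyshevTransform, ballot_zero]
  | one =>
    have h := ballot_zero_succ (R := R) m
    simp only [ballot_zero] at h
    simp [chebyshevTransform, sum_range_succ, h]
  | more n ih₀ ih₁ =>
    rw [chebyshevTransform_add_two le_rfl, ih₀, ih₁]
    have h := ih₁ (m + 1)
    simp only [add_assoc (m + 1) 1, add_comm 1] at h
    rw [h, ballot_succ_succ]
    ring

theorem chebyshevTransform_zero_pow_add_two (x : R) (n : ℕ) :
    chebyshevTransform 0 (n + 2) (x ^ ·) =
      (2 - x) * chebyshevTransform 0 (n + 1) (x ^ ·) - chebyshevTransform 0 n (x ^ ·) := by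
  simp only [chebyshevTransform_add_two zero_le_one, pow_succ', chebyshevTransform_const_mul]
  ring

theorem chebyshevTransform_one_eq_zero_pow {x : R} {r : ℕ → R} (h₀ : r 0 = 1)
    (hr : ∀ m, r (m + 1) = x * r m + catalan (m + 1)) (n : ℕ) :
    chebyshevTransform 1 n r = chebyshevTransform 0 n (x ^ ·) := by
  induction n using Nat.twoStepInduction with
  | zero => simp [chebyshevTransform, h₀]
  | one =>
    simp [chebyshevTransform, sum_range_succ, h₀, hr]
    ring
  | more n ih₀ ih₁ =>
    have h := chebyshevTransform_one_catalan (R := R) (n + 1) 0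
    simp only [zero_add, add_comm 1, ballot_eq_zero n.succ_pos, mul_zero] at h
    rw [chebyshevTransform_zero_pow_add_two, chebyshevTransform_add_two le_rfl]
    simp only [hr, chebyshevTransform_add, chebyshevTransform_const_mul, h, ih₀, ih₁]
    ring

theorem chebyshevTransform_one_shift_succ {x : R} {r : ℕ → R}
    (hr : ∀ m, r (m + 1) = x * r m + catalan (m + 1)) (i k : ℕ) :
    chebyshevTransform 1 k (fun j => r (i + 1 + j)) =
      (-1) ^ k * ballot R k i + x * chebyshevTransform 1 k (fun j => r (i + j)) := by
  rw [← chebyshevTransform_one_catalan, ← chebyshevTransform_const_mul, ← chebyshevTransform_add]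
  congr 1
  ext j
  rw [show i + 1 + j = i + j + 1 by ring, hr, add_comm]

theorem det_hankel_eq_chebyshevTransform {x : R} {r : ℕ → R} (h₀ : r 0 = 1)
    (hr : ∀ m, r (m + 1) = x * r m + catalan (m + 1)) (n : ℕ) :
    (Matrix.of fun i j : Fin (n + 1) => r ((i : ℕ) + (j : ℕ))).det =
      chebyshevTransform 0 n (x ^ ·) := by
  set H : Matrix (Fin (n + 1)) (Fin (n + 1)) R := Matrix.of fun i j => r ((i : ℕ) + (j : ℕ))
  let A : Matrix (Fin (n + 1)) (Fin (n + 1)) R := Matrix.of fun j k =>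
    (-1) ^ (j : ℕ) * (((k : ℕ) + j + 1).choose (2 * j + 1) : R)
  let B : Matrix (Fin (n + 1)) (Fin (n + 1)) R := Matrix.of fun i k =>
    Fin.cases (chebyshevTransform 1 k r) (fun i' => (-1) ^ (k : ℕ) * ballot R k i') i
  have hA : A.det = ∏ k ∈ range (n + 1), (-1) ^ k := by
    rw [Matrix.det_of_isUpperTriangular, ← Fin.prod_univ_eq_prod_range]
    · refine prod_congr rfl fun k _ => ?_
      simp [A, two_mul]
    · intro j k hjk
      have hjk' : (k : ℕ) < j := hjk
      simp [A, Nat.choose_eq_zero_of_lt (show (k : ℕ) + j + 1 < 2 * j + 1 by omega)]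
  have hHA (i k) : (H * A) i k = chebyshevTransform 1 k (fun j => r (i + j)) := by
    rw [chebyshevTransform_eq_sum_range k.isLt, ← Fin.sum_univ_eq_sum_range
      (fun j => (-1) ^ j * (((k : ℕ) + j + 1).choose (2 * j + 1) : R) * r (i + j)),
      Matrix.mul_apply]
    exact sum_congr rfl fun j _ => mul_comm _ _
  have hHB : (H * A).det = B.det := by
    refine Matrix.det_eq_of_forall_row_eq_smul_add_pred (fun _ => x) (fun k => ?_) fun i k => ?_
    · simp [hHA, B]
    · simpa [hHA, B] using chebyshevTransform_one_shift_succ hr i k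
  have hB : B.det = chebyshevTransform 0 n (x ^ ·) * ∏ k ∈ range (n + 1), (-1) ^ k := by
    rw [Matrix.det_succ_column B (Fin.last n), Fin.sum_univ_succ, sum_eq_zero, add_zero,
      Matrix.det_of_isLowerTriangular, prod_range_succ, ← Fin.prod_univ_eq_prod_range]
    · simp [B, ballot_self, chebyshevTransform_one_eq_zero_pow h₀ hr]
      ring
    · intro i k hik
      have hik' : (i : ℕ) < k := hik
      simp [B, ballot_eq_zero hik']
    · intro i _
      simp [B, ballot_eq_zero i.isLt]
  have hunit : IsUnit (∏ k ∈ range (n + 1), (-1 : R) ^ k) := by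
    rw [prod_pow_eq_pow_sum]
    exact isUnit_neg_one.pow _
  rw [← hunit.mul_left_inj, ← hB, ← hHB, Matrix.det_mul, hA]

end CommRing

theorem hankel_catalan_convolution_det (n : ℕ)
    (r : ℕ → Polynomial ℚ)
    (hr : ∀ m, r m = ∑ k ∈ range (m + 1), Polynomial.C (catalan (m - k) : ℚ) * X ^ k) :
    (Matrix.of fun i j : Fin (n + 1) => r ((i : ℕ) + (j : ℕ))).det
      = Polynomial.C ((Matrix.of fun i j : Fin (n + 1) =>
          (catalan ((i : ℕ) + (j : ℕ)) : ℚ)).det)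
        * ∑ j ∈ range (n + 1), (-1 : Polynomial ℚ) ^ j
            * Polynomial.C ((n + j).choose (n - j) : ℚ) * X ^ j := by
  have h₀ : r 0 = 1 := by simp [hr]
  have h_succ (m : ℕ) : r (m + 1) = X * r m + (catalan (m + 1) : ℚ[X]) := by
    rw [hr, hr, sum_range_succ', mul_sum]
    congr 1
    · refine sum_congr rfl fun k _ => ?_
      rw [Nat.add_sub_add_right]
      ring
    · simp
  have h_one := det_hankel_eq_chebyshevTransform (x := 0) (r := fun m => (catalan m : ℚ))
    (by simp) (by simp) n
  rw [det_hankel_eq_chebyshevTransform h₀ h_succ, h_one]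
  have h_eval : chebyshevTransform 0 n ((0 : ℚ) ^ ·) = 1 := by
    simp [chebyshevTransform, sum_range_succ']
  rw [h_eval, map_one, one_mul, chebyshevTransform]
  refine sum_congr rfl fun j hj => ?_
  have hj' : j ≤ n := Nat.lt_succ_iff.1 (mem_range.1 hj)
  rw [← Nat.choose_symm (show n - j ≤ n + j by omega), show n + j - (n - j) = 2 * j by omega]
  simp
end

section
/- Let B_n = binom(2n,n) and r(n,x) = Σ_{k=0}^{n} B_{n-k} x^k. Then det((r(i+j,x))_{i,j=0}^{n}) / det((B_{i+j})_{i,j=0}^{n}) = Σ_{j=0}^{n} (-1)^j binom(n+j, n-j) x^j as polynomials in x. -/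
open Polynomial Finset

/-- The polynomials `(-1) ^ n * cos ((2 * n + 1) * θ) / cos θ` in the variable `X = 4 * cos θ ^ 2`. -/
noncomputable def altOddCosPoly : ℕ → ℚ[X]
  | 0 => 1
  | 1 => 3 - X
  | n + 2 => 2 * altOddCosPoly (n + 1) - X * altOddCosPoly (n + 1) - altOddCosPoly n

/-- The linear functional on polynomials whose moment sequence is `b`. -/
noncomputable def momentFunctional (b : ℕ → ℚ) : ℚ[X] →ₗ[ℚ] ℚ :=
  Polynomial.lsum fun j => b j • LinearMap.id

theorem momentFunctional_monomial (b : ℕ → ℚ) (j : ℕ) (a : ℚ) :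
    momentFunctional b (monomial j a) = b j * a := by
  simp [momentFunctional, Polynomial.lsum_apply, Polynomial.sum_monomial_index]

theorem momentFunctional_one (b : ℕ → ℚ) : momentFunctional b 1 = b 0 := by
  simpa using momentFunctional_monomial b 0 1

theorem momentFunctional_X_mul (b : ℕ → ℚ) (p : ℚ[X]) :
    momentFunctional b (X * p) = momentFunctional (fun j => b (j + 1)) p := by
  induction p using Polynomial.induction_on' with
  | add p q hp hq => rw [mul_add, map_add, map_add, hp, hq]
  | monomial j a => rw [X_mul_monomial, momentFunctional_monomial, momentFunctional_monomial]

theorem momentFunctional_eq_sum (b : ℕ → ℚ) {p : ℚ[X]} {n : ℕ} (hp : p.natDegree < n) :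
    momentFunctional b p = ∑ j ∈ range n, b j * p.coeff j := by
  conv_lhs => rw [p.as_sum_range' n hp]
  simp [momentFunctional_monomial]

theorem momentFunctional_altOddCosPoly_one (b : ℕ → ℚ) :
    momentFunctional b (altOddCosPoly 1) = 3 * b 0 - b 1 := by
  have h : altOddCosPoly 1 = (3 : ℚ) • (1 : ℚ[X]) - X * 1 := by
    rw [altOddCosPoly, smul_eq_C_mul, mul_one, mul_one, map_ofNat]
  rw [h, map_sub, map_smul, momentFunctional_X_mul, momentFunctional_one, momentFunctional_one,
    smul_eq_mul]

theorem momentFunctional_altOddCosPoly_add_two (b : ℕ → ℚ) (n : ℕ) :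
    momentFunctional b (altOddCosPoly (n + 2)) = 2 * momentFunctional b (altOddCosPoly (n + 1))
      - momentFunctional (fun j => b (j + 1)) (altOddCosPoly (n + 1))
      - momentFunctional b (altOddCosPoly n) := by
  rw [altOddCosPoly, map_sub, map_sub, momentFunctional_X_mul, two_mul, map_add, two_mul]

theorem natDegree_altOddCosPoly_le (n : ℕ) : (altOddCosPoly n).natDegree ≤ n := by
  induction n using Nat.twoStepInduction with
  | zero => simp [altOddCosPoly]
  | one => rw [altOddCosPoly]; compute_degree
  | more n h₀ h₁ =>
    rw [altOddCosPoly]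
    have hX : (X * altOddCosPoly (n + 1)).natDegree ≤ n + 2 :=
      natDegree_mul_le.trans (by rw [natDegree_X]; omega)
    have h2 : (2 * altOddCosPoly (n + 1)).natDegree ≤ n + 2 :=
      natDegree_mul_le.trans (by rw [natDegree_ofNat]; omega)
    refine (natDegree_sub_le _ _).trans (max_le ?_ (by omega))
    exact (natDegree_sub_le _ _).trans (max_le h2 hX)

theorem coeff_zero_altOddCosPoly (n : ℕ) : (altOddCosPoly n).coeff 0 = 2 * n + 1 := by
  induction n using Nat.twoStepInduction with
  | zero => simp [altOddCosPoly]
  | one => norm_num [altOddCosPoly, coeff_zero_eq_eval_zero]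
  | more n h₀ h₁ =>
    rw [coeff_zero_eq_eval_zero] at h₀ h₁ ⊢
    simp only [altOddCosPoly, eval_sub, eval_mul, eval_X, eval_ofNat, h₀, h₁]
    push_cast
    ring

theorem Nat.centralBinom_succ_eq_two_mul_choose (e : ℕ) :
    Nat.centralBinom (e + 1) = 2 * (2 * e + 1).choose (e + 1) := by
  rw [Nat.centralBinom_eq_two_mul_choose, show 2 * (e + 1) = 2 * e + 1 + 1 by ring,
    Nat.choose_succ_succ, Nat.choose_symm_half]
  ring

theorem Nat.choose_add_two_add_two (n k : ℕ) :
    (n + 2).choose (k + 2) = n.choose k + 2 * n.choose (k + 1) + n.choose (k + 2) := by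
  rw [Nat.choose_succ_succ, Nat.choose_succ_succ, Nat.choose_succ_succ n (k + 1)]
  ring

theorem momentFunctional_centralBinom_add (n e : ℕ) :
    momentFunctional (fun j => (Nat.centralBinom (j + (e + 1)) : ℚ)) (altOddCosPoly n)
      = 2 * (-1) ^ n * ((2 * e + 1).choose (e + n + 1) : ℚ) := by
  induction n using Nat.twoStepInduction generalizing e with
  | zero =>
    rw [altOddCosPoly, momentFunctional_one, zero_add, Nat.centralBinom_succ_eq_two_mul_choose]
    push_cast
    ring
  | one =>
    rw [momentFunctional_altOddCosPoly_one, zero_add, show 1 + (e + 1) = e + 1 + 1 by ring,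
      Nat.centralBinom_succ_eq_two_mul_choose, Nat.centralBinom_succ_eq_two_mul_choose,
      show 2 * (e + 1) + 1 = 2 * e + 1 + 2 by ring, Nat.choose_add_two_add_two,
      ← Nat.choose_symm_half]
    push_cast
    ring
  | more n h₀ h₁ =>
    have h₂ := h₁ (e + 1)
    rw [show 2 * (e + 1) + 1 = 2 * e + 1 + 2 by ring,
      show e + 1 + (n + 1) + 1 = e + n + 1 + 2 by ring, Nat.choose_add_two_add_two] at h₂
    rw [momentFunctional_altOddCosPoly_add_two, h₀, h₁]
    simp only [show ∀ j, j + 1 + (e + 1) = j + (e + 1 + 1) by intro j; ring]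
    rw [h₂, show e + (n + 1) + 1 = e + n + 1 + 1 by ring,
      show e + (n + 2) + 1 = e + n + 1 + 2 by ring]
    push_cast
    ring

theorem momentFunctional_centralBinom_sub (n k : ℕ) :
    momentFunctional (fun j => if k ≤ j then (Nat.centralBinom (j - k) : ℚ) else 0)
      (altOddCosPoly n) = (-1) ^ k * ((n + k).choose (2 * k) : ℚ) := by
  induction n using Nat.twoStepInduction generalizing k with
  | zero =>
    rw [altOddCosPoly, momentFunctional_one]
    rcases k with _ | k
    · simp
    · rw [Nat.choose_eq_zero_of_lt (by omega)]
      simp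
  | one =>
    rw [momentFunctional_altOddCosPoly_one]
    rcases k with _ | _ | k
    · norm_num [Nat.centralBinom]
    · norm_num
    · simp [Nat.choose_eq_zero_of_lt (show 1 + (k + 1 + 1) < 2 * (k + 1 + 1) by omega)]
  | more n h₀ h₁ =>
    rw [momentFunctional_altOddCosPoly_add_two, h₀, h₁]
    rcases k with _ | k
    · have h := momentFunctional_centralBinom_add (n + 1) 0
      rw [Nat.choose_eq_zero_of_lt (by omega)] at h
      simp only [zero_add, Nat.cast_zero, mul_zero] at h
      simp only [Nat.zero_le, if_true, Nat.sub_zero, h]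
      norm_num
    · simp only [Nat.add_le_add_iff_right, Nat.add_sub_add_right, h₁]
      rw [show n + 2 + (k + 1) = n + 1 + k + 2 by ring, show 2 * (k + 1) = 2 * k + 2 by ring,
        Nat.choose_add_two_add_two, show n + 1 + (k + 1) = n + 1 + k + 1 by ring,
        show n + (k + 1) = n + 1 + k by ring, Nat.choose_succ_succ (n + 1 + k) (2 * k + 1)]
      push_cast
      ring

/-- If `A *ᵥ v` is the `i`-th basis vector, replacing the `i`-th row of `A` by `w` multiplies the
determinant by `w ⬝ᵥ v`. -/
theorem Matrix.det_updateRow_eq_of_mulVec_eq_single {R m : Type*} [CommRing R] [IsDomain R]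
    [Fintype m] [DecidableEq m] (A : Matrix m m R) (i : m) (w v : m → R)
    (hv : v i ≠ 0) (h : A.mulVec v = Pi.single i 1) :
    (A.updateRow i w).det = A.det * (w ⬝ᵥ v) := by
  have hw : (A.updateRow i w).mulVec v = Pi.single i (w ⬝ᵥ v) := by
    ext l
    rcases eq_or_ne l i with rfl | hl
    · simp [Matrix.mulVec]
    · have := congrFun h l
      simp_all [Matrix.mulVec]
  have key (B : Matrix m m R) (c : R) (hB : B.mulVec v = Pi.single i c) :
      B.det * v i = c * B.adjugate i i := by
    have := congrFun (congrArg B.adjugate.mulVec hB) i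
    simpa [Matrix.mulVec_mulVec, Matrix.adjugate_mul, Matrix.smul_mulVec, mul_comm] using this
  have h₁ := key A 1 h
  have h₂ := key _ _ hw
  rw [Matrix.adjugate_apply, Matrix.updateRow_idem, ← Matrix.adjugate_apply] at h₂
  apply mul_right_cancel₀ hv
  rw [h₂]
  linear_combination -(w ⬝ᵥ v) * h₁

theorem hankel_central_binom_convolution_det (n : ℕ)
    (r : ℕ → Polynomial ℚ)
    (hr : ∀ m, r m = ∑ k ∈ range (m + 1), Polynomial.C (Nat.centralBinom (m - k) : ℚ) * X ^ k) :
    (Matrix.of fun i j : Fin (n + 1) => r ((i : ℕ) + (j : ℕ))).det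
      = Polynomial.C ((Matrix.of fun i j : Fin (n + 1) =>
          (Nat.centralBinom ((i : ℕ) + (j : ℕ)) : ℚ)).det)
        * ∑ j ∈ range (n + 1), (-1 : Polynomial ℚ) ^ j
            * Polynomial.C ((n + j).choose (n - j) : ℚ) * X ^ j := by
  have hr_succ (m : ℕ) : r (m + 1) = C (Nat.centralBinom (m + 1) : ℚ) + X * r m := by
    rw [hr, hr, sum_range_succ', mul_sum, add_comm]
    congr 1
    · simp
    · refine sum_congr rfl fun k _ => ?_
      rw [Nat.add_sub_add_right]
      ring
  have hcoeff (m k : ℕ) :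
      (r m).coeff k = if k ≤ m then (Nat.centralBinom (m - k) : ℚ) else 0 := by
    simp [hr, coeff_X_pow]
  have hdeg : (altOddCosPoly n).natDegree < n + 1 :=
    Nat.lt_succ_of_le (natDegree_altOddCosPoly_le n)
  set H : Matrix (Fin (n + 1)) (Fin (n + 1)) ℚ :=
    Matrix.of fun i j => (Nat.centralBinom ((i : ℕ) + (j : ℕ)) : ℚ) with hH
  set v : Fin (n + 1) → ℚ[X] := fun j => C ((altOddCosPoly n).coeff j) with hv
  have hrow : (Matrix.of fun i j : Fin (n + 1) => r ((i : ℕ) + (j : ℕ))).det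
      = ((C.mapMatrix H).updateRow 0 fun j => r j).det := by
    refine Matrix.det_eq_of_forall_row_eq_smul_add_pred (fun _ => X) (fun j => by simp) ?_
    intro i j
    rw [Matrix.updateRow_ne (Fin.succ_ne_zero i)]
    simp only [Matrix.of_apply, hH, RingHom.mapMatrix_apply, Matrix.map_apply, Fin.val_succ,
      Fin.val_castSucc]
    rw [show (i : ℕ) + 1 + j = i + j + 1 by ring, hr_succ]
  have hHv : (C.mapMatrix H).mulVec v = Pi.single 0 1 := by
    ext1 i
    have hC : (C.mapMatrix H).mulVec v i = C (momentFunctional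
        (fun j => (Nat.centralBinom (j + i) : ℚ)) (altOddCosPoly n)) := by
      rw [momentFunctional_eq_sum _ hdeg, sum_range, map_sum]
      simp [Matrix.mulVec, dotProduct, hH, hv, add_comm]
    rw [hC]
    refine Fin.cases ?_ (fun e => ?_) i
    · have := momentFunctional_centralBinom_sub n 0
      simp at this
      simp [this]
    · rw [Fin.val_succ, momentFunctional_centralBinom_add, Nat.choose_eq_zero_of_lt (by omega)]
      simp
  have hrv : (fun j : Fin (n + 1) => r j) ⬝ᵥ v = ∑ j ∈ range (n + 1), (-1 : Polynomial ℚ) ^ j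
            * Polynomial.C ((n + j).choose (n - j) : ℚ) * X ^ j := by
    ext k
    have hsum : ((fun j : Fin (n + 1) => r j) ⬝ᵥ v).coeff k
        = (-1) ^ k * ((n + k).choose (2 * k) : ℚ) := by
      rw [← momentFunctional_centralBinom_sub, momentFunctional_eq_sum _ hdeg, sum_range]
      simp only [dotProduct, finsetSum_coeff, hv, coeff_mul_C, hcoeff]
    have hterm (j : ℕ) : (-1 : ℚ[X]) ^ j * C ((n + j).choose (n - j) : ℚ) * X ^ j
        = C ((-1) ^ j * ((n + j).choose (n - j) : ℚ)) * X ^ j := by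
      simp
    rw [hsum]
    simp only [hterm, finsetSum_coeff, coeff_C_mul, coeff_X_pow, mul_ite, mul_one, mul_zero,
      sum_ite_eq, mem_range]
    split_ifs with hk
    · rw [← Nat.choose_symm (show n - k ≤ n + k by omega),
        show n + k - (n - k) = 2 * k by omega]
    · rw [Nat.choose_eq_zero_of_lt (by omega)]
      simp
  have hv0 : v 0 ≠ 0 := by
    simp only [hv, Fin.val_zero, coeff_zero_altOddCosPoly, ne_eq, C_eq_zero]
    positivity
  rw [hrow, Matrix.det_updateRow_eq_of_mulVec_eq_single _ _ _ _ hv0 hHv, hrv, RingHom.map_det]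
end

section
/- Under the hypotheses of the moment setup (p_n = x p_{n-1} − t_{n-2} p_{n-2}, moments a(n) = Λ(x^{2n}), coefficients v(n,k)), for every n ≥ 0: det((a(i+j)x − a(i+j+1))_{i,j=0}^{n}) / det((a(i+j))_{i,j=0}^{n}) = Σ_{k=0}^{n+1} (−1)^k v(2n+2, k)·x^{n+1−k}, i.e., equals p_{2n+2}(√x) viewed as a polynomial in x. -/
open Polynomial Finset

/-- The characteristic polynomial of the companion matrix of a monic polynomial `q` is `q`. -/
theorem charpoly_companion {K : Type*} [Field K] {q : K[X]} (hq : q.Monic) {d : ℕ}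
    (hd : q.natDegree = d) :
    (Matrix.of fun i j : Fin d =>
      if (j : ℕ) + 1 = d then -q.coeff i else if (i : ℕ) = j + 1 then 1 else 0).charpoly = q := by
  subst hd
  have hgen := AdjoinRoot.minpoly_powerBasis_gen_of_monic hq
  have h := charpoly_leftMulMatrix (AdjoinRoot.powerBasis hq.ne_zero)
  rw [PowerBasis.leftMulMatrix, PowerBasis.minpolyGen_eq, hgen] at h
  exact h

/-- If a functional `L` annihilates `q * X ^ i` for all `i < d`, where `q` is monic of degree `d`,
then the linear Hankel pencil of its moments has determinant a multiple of `q`. -/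
theorem det_hankel_pencil {K : Type*} [Field K] (L : K[X] →ₗ[K] K) {q : K[X]} (hq : q.Monic)
    {d : ℕ} (hd : q.natDegree = d) (hL : ∀ i < d, L (X ^ i * q) = 0) :
    (Matrix.of fun i j : Fin d =>
        C (L (X ^ ((i : ℕ) + j))) * X - C (L (X ^ ((i : ℕ) + j + 1)))).det
      = C (Matrix.of fun i j : Fin d => L (X ^ ((i : ℕ) + j))).det * q := by
  set H : Matrix (Fin d) (Fin d) K := Matrix.of fun i j => L (X ^ ((i : ℕ) + j)) with hH
  set M : Matrix (Fin d) (Fin d) K := Matrix.of fun i j =>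
    if (j : ℕ) + 1 = d then -q.coeff i else if (i : ℕ) = j + 1 then 1 else 0 with hM
  have hHM : H * M = Matrix.of fun i j : Fin d => L (X ^ ((i : ℕ) + j + 1)) := by
    ext i j
    simp only [Matrix.mul_apply, hH, hM, Matrix.of_apply]
    split_ifs with h
    · have hcoeff : q.coeff d = 1 := hd ▸ hq.coeff_natDegree
      have key := hL i i.2
      rw [q.as_sum_range_C_mul_X_pow, hd, Finset.sum_range_succ, mul_add, map_add, hcoeff, C_1,
        one_mul, ← pow_add, Finset.mul_sum, map_sum, Finset.sum_range] at key
      rw [add_assoc, h, eq_neg_of_add_eq_zero_right key, ← Finset.sum_neg_distrib]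
      refine Finset.sum_congr rfl fun k _ => ?_
      rw [mul_left_comm, ← pow_add, ← smul_eq_C_mul, map_smul, smul_eq_mul]
      ring
    · rw [Finset.sum_eq_single (⟨j + 1, by omega⟩ : Fin d)]
      · simp [add_assoc]
      · intro k _ hk
        rw [if_neg (fun h' => hk (Fin.ext h')), mul_zero]
      · simp
  have hfac : (Matrix.of fun i j : Fin d =>
        C (L (X ^ ((i : ℕ) + j))) * X - C (L (X ^ ((i : ℕ) + j + 1))))
      = H.map C * M.charmatrix := by
    rw [Matrix.charmatrix, RingHom.mapMatrix_apply, mul_sub, ← Matrix.map_mul, hHM]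
    ext1 i j
    simp [hH, Matrix.scalar_apply, Matrix.mul_diagonal]
  have hdet : M.charmatrix.det = q := charpoly_companion hq hd
  rw [hfac, Matrix.det_mul, hdet, RingHom.map_det, RingHom.mapMatrix_apply]

section SymmetricRecurrence

variable {K : Type*} [Field K] {t : ℕ → K} {p : ℕ → K[X]}

/-- Polynomials with a symmetric three-term recurrence are even or odd, and monic. -/
theorem exists_expand_of_symmetric_recurrence (hp0 : p 0 = 1) (hp1 : p 1 = X)
    (hp : ∀ n, p (n + 2) = X * p (n + 1) - C (t n) * p n) (m : ℕ) :
    ∃ q r : K[X], p (2 * m) = expand K 2 q ∧ p (2 * m + 1) = X * expand K 2 r ∧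
      q.Monic ∧ q.natDegree = m ∧ r.Monic ∧ r.natDegree = m := by
  induction m with
  | zero => exact ⟨1, 1, by simp [hp0], by simp [hp1], monic_one, by simp, monic_one, by simp⟩
  | succ m ih =>
    obtain ⟨q, r, hq, hr, hqm, hqd, hrm, hrd⟩ := ih
    have hXr : (X * r).natDegree = m + 1 := by rw [natDegree_X_mul hrm.ne_zero, hrd]
    have hlt : (C (t (2 * m)) * q).degree < (X * r).degree :=
      degree_lt_degree (by
        have := natDegree_C_mul_le (t (2 * m)) q
        omega)
    have hq'm := (monic_X.mul hrm).sub_of_left hlt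
    have hq'd : (X * r - C (t (2 * m)) * q).natDegree = m + 1 := by
      rw [natDegree_eq_of_degree_eq (degree_sub_eq_left_of_degree_lt hlt), hXr]
    have hlt' : (C (t (2 * m + 1)) * r).degree < (X * r - C (t (2 * m)) * q).degree :=
      degree_lt_degree (by
        have := natDegree_C_mul_le (t (2 * m + 1)) r
        omega)
    have hq' : p (2 * m + 2) = expand K 2 (X * r - C (t (2 * m)) * q) := by
      rw [hp, hr, hq, map_sub, map_mul, map_mul, expand_X, expand_C]
      ring
    refine ⟨X * r - C (t (2 * m)) * q,
      X * r - C (t (2 * m)) * q - C (t (2 * m + 1)) * r, hq', ?_, hq'm, hq'd,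
      hq'm.sub_of_left hlt', ?_⟩
    · rw [show 2 * (m + 1) + 1 = 2 * m + 1 + 2 by ring, hp, hq', hr,
        map_sub _ (X * r - C (t (2 * m)) * q), map_mul _ (C (t (2 * m + 1))), expand_C]
      ring
    · rw [natDegree_eq_of_degree_eq (degree_sub_eq_left_of_degree_lt hlt'), hq'd]

theorem functional_X_pow_mul_eq_zero
    (hp : ∀ n, p (n + 2) = X * p (n + 1) - C (t n) * p n) {Λ : K[X] →ₗ[K] K}
    (hΛ : ∀ n ≠ 0, Λ (p n) = 0) {j m : ℕ} (hjm : j < m) : Λ (X ^ j * p m) = 0 := by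
  induction j generalizing m with
  | zero => simpa using hΛ m hjm.ne'
  | succ j ih =>
    obtain ⟨k, rfl⟩ := Nat.exists_eq_add_of_le' (show 1 ≤ m by omega)
    obtain ⟨k, rfl⟩ := Nat.exists_eq_add_of_le' (show 1 ≤ k by omega)
    have h : X ^ (j + 1) * p (k + 1 + 1) =
        X ^ j * p (k + 1 + 2) + t (k + 1) • (X ^ j * p (k + 1)) := by
      rw [hp (k + 1), smul_eq_C_mul]
      ring
    rw [h, map_add, map_smul, ih (by omega), ih (by omega), smul_zero, add_zero]

end SymmetricRecurrence

theorem symmetric_moment_linear_hankel_det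
    (t : ℕ → ℚ) (ht : ∀ n, t n ≠ 0)
    (p : ℕ → Polynomial ℚ)
    (hp0 : p 0 = 1) (hp1 : p 1 = X)
    (hp : ∀ n, p (n + 2) = X * p (n + 1) - Polynomial.C (t n) * p n)
    (v : ℕ → ℕ → ℚ)
    (hv : ∀ n k, v n k = (-1 : ℚ) ^ k * (p n).coeff (n - 2 * k))
    (Λ : Polynomial ℚ →ₗ[ℚ] ℚ)
    (hΛ : ∀ n, Λ (p n) = if n = 0 then 1 else 0)
    (a : ℕ → ℚ) (ha : ∀ n, a n = Λ (X ^ (2 * n)))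
    (n : ℕ) :
    (Matrix.of fun i j : Fin (n + 1) =>
        Polynomial.C (a ((i : ℕ) + (j : ℕ))) * X
          - Polynomial.C (a ((i : ℕ) + (j : ℕ) + 1))).det
      = Polynomial.C ((Matrix.of fun i j : Fin (n + 1) =>
          a ((i : ℕ) + (j : ℕ))).det)
        * ∑ k ∈ range (n + 2), (-1 : Polynomial ℚ) ^ k
            * Polynomial.C (v (2 * n + 2) k) * X ^ (n + 1 - k) := by
  obtain ⟨q, -, hq, -, hqm, hqd, -, -⟩ :=
    exists_expand_of_symmetric_recurrence hp0 hp1 hp (n + 1)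
  have hsum : ∑ k ∈ range (n + 2), (-1 : Polynomial ℚ) ^ k
      * Polynomial.C (v (2 * n + 2) k) * X ^ (n + 1 - k) = q := by
    conv_rhs => rw [q.as_sum_range_C_mul_X_pow, hqd, ← Finset.sum_range_reflect]
    refine Finset.sum_congr rfl fun k _ => ?_
    have hcoeff : (p (2 * n + 2)).coeff (2 * n + 2 - 2 * k) = q.coeff (n + 1 - k) := by
      rw [show 2 * n + 2 - 2 * k = 2 * (n + 1 - k) by omega, show 2 * n + 2 = 2 * (n + 1) by ring,
        hq, coeff_expand_mul' two_pos]
    rw [hv, hcoeff, C_mul, ← mul_assoc, C_pow, C_neg, C_1, ← mul_pow, neg_mul_neg, one_mul,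
      one_pow, one_mul, Nat.add_sub_cancel]
  have hL : ∀ i < n + 1, (Λ ∘ₗ (expand ℚ 2).toLinearMap) (X ^ i * q) = 0 := by
    intro i hi
    have h := functional_X_pow_mul_eq_zero hp (Λ := Λ) (fun m hm => by rw [hΛ, if_neg hm])
      (show 2 * i < 2 * (n + 1) by omega)
    rw [hq] at h
    simpa [pow_mul] using h
  have hmoment : ∀ m, a m = (Λ ∘ₗ (expand ℚ 2).toLinearMap) (X ^ m) := by
    intro m
    simp [ha, pow_mul]
  simp only [hsum, hmoment]
  exact det_hankel_pencil _ hqm hqd hL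
end
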